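/- Fix r ∈ ℕ* and a real constant c > 0 such that η(C_m^r) ≤ c(m−1)+1 for every m ∈ ℕ*. Then for every prime p and all positive integers α, one has t(C_{p^α}^r) ≤ c(p^α − 1) + 1. -/

import Mathlib

open Multiset Finset

/-- The cross number of a sequence (multiset) over an additive group:
    the sum of the reciprocals of the orders of its elements. -/
noncomputable def crossNum {G : Type*} [AddCommGroup G] (S : Multiset G) : ℝ :=
  (S.map fun g => (1 : ℝ) / (addOrderOf g : ℝ)).sum

/-- A tiny zero-sum sequence: non-empty, zero sum, cross number at most 1. -/
def IsTinyZS {G : Type*} [AddCommGroup G] (S' : Multiset G) : Prop :=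
  S' ≠ 0 ∧ S'.sum = 0 ∧ crossNum S' ≤ 1

/-- `tC G` : the smallest `t ≥ 1` such that every sequence over `G` of length `≥ t`
    contains a tiny zero-sum subsequence. -/
noncomputable def tC (G : Type*) [AddCommGroup G] : ℕ :=
  sInf {t : ℕ | 0 < t ∧ ∀ S : Multiset G, t ≤ Multiset.card S → ∃ S' ≤ S, IsTinyZS S'}

/-- `etaC G` : the smallest `t ≥ 1` such that every sequence over `G` of length `≥ t`
    contains a non-empty zero-sum subsequence of length at most `exp(G)`. -/
noncomputable def etaC (G : Type*) [AddCommGroup G] : ℕ :=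
  sInf {t : ℕ | 0 < t ∧ ∀ S : Multiset G, t ≤ Multiset.card S →
    ∃ S' ≤ S, S' ≠ 0 ∧ S'.sum = 0 ∧ Multiset.card S' ≤ AddMonoid.exponent G}

/-- `etaDD G d' d` : the smallest `t ≥ 1` such that every sequence over
    `G_d = {x : G | d • x = 0}` of length `≥ t` contains a non-empty subsequence of length
    at most `d'` whose sum lies in `G_{d/d'}`. -/
noncomputable def etaDD (G : Type*) [AddCommGroup G] (d' d : ℕ) : ℕ :=
  sInf {t : ℕ | 0 < t ∧ ∀ S : Multiset G, (∀ g ∈ S, d • g = 0) → t ≤ Multiset.card S →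
    ∃ S' ≤ S, S' ≠ 0 ∧ Multiset.card S' ≤ d' ∧ (d / d') • S'.sum = 0}

/-- `rhoC G` : the maximum of the cross numbers of sequences over `G` containing
    no tiny zero-sum subsequence. -/
noncomputable def rhoC (G : Type*) [AddCommGroup G] : ℝ :=
  sSup {x : ℝ | ∃ S : Multiset G, (¬ ∃ S' ≤ S, IsTinyZS S') ∧ crossNum S = x}

/-- `maxPF n = P⁺(n)`, the greatest prime divisor of `n`, with `P⁺(1) = 1`. -/
def maxPF (n : ℕ) : ℕ := if n = 1 then 1 else n.primeFactors.sup id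

/-- `G` is a finite abelian group of rank `r`, i.e. `G ≅ C_{n₁} ⊕ ⋯ ⊕ C_{n_r}` with
    `1 < n₁ ∣ ⋯ ∣ n_r`. -/
def HasRank (G : Type*) [AddCommGroup G] (r : ℕ) : Prop :=
  ∃ n : Fin r → ℕ, (∀ i, 1 < n i) ∧ (∀ i j : Fin r, i ≤ j → n i ∣ n j) ∧
    Nonempty (G ≃+ ((i : Fin r) → ZMod (n i)))


section CrossNumber

variable {G : Type*} [AddCommGroup G]

theorem crossNum_add (S T : Multiset G) : crossNum (S + T) = crossNum S + crossNum T := by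
  simp [crossNum]

theorem crossNum_cons (g : G) (S : Multiset G) :
    crossNum (g ::ₘ S) = 1 / (addOrderOf g : ℝ) + crossNum S := by
  simp [crossNum]

/-- If a sequence has no tiny zero-sum subsequence, then replacing a non-empty block by its sum
preserves this property as soon as the cross number of the block does not exceed that of its
sum. -/
theorem not_exists_isTinyZS_cons_sum {B V : Multiset G} (hB : B ≠ 0)
    (hcross : crossNum B ≤ 1 / (addOrderOf B.sum : ℝ))
    (h : ¬ ∃ W ≤ B + V, IsTinyZS W) : ¬ ∃ W ≤ B.sum ::ₘ V, IsTinyZS W := by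
  rintro ⟨W, hW, hW0, hWsum, hWcross⟩
  by_cases hmem : B.sum ∈ W
  · obtain ⟨W', rfl⟩ := Multiset.exists_cons_of_mem hmem
    rw [Multiset.cons_le_cons_iff] at hW
    rw [Multiset.sum_cons] at hWsum
    rw [crossNum_cons] at hWcross
    refine h ⟨B + W', by gcongr, by simp [hB], by rw [Multiset.sum_add, hWsum], ?_⟩
    rw [crossNum_add]
    linarith
  · exact h ⟨W, ((Multiset.le_cons_of_notMem hmem).1 hW).trans (Multiset.le_add_left _ _),
      hW0, hWsum, hWcross⟩

end CrossNumber

theorem Multiset.exists_le_map_eq {α β : Type*} (f : α → β) {S : Multiset α} {W : Multiset β}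
    (h : W ≤ S.map f) : ∃ B ≤ S, B.map f = W := by
  classical
  induction S using Multiset.induction_on generalizing W with
  | empty => exact ⟨0, le_rfl, by simpa [eq_comm] using h⟩
  | cons a S ih =>
    rw [Multiset.map_cons] at h
    by_cases ha : f a ∈ W
    · obtain ⟨W', rfl⟩ := Multiset.exists_cons_of_mem ha
      rw [Multiset.cons_le_cons_iff] at h
      obtain ⟨B, hB, rfl⟩ := ih h
      exact ⟨a ::ₘ B, (Multiset.cons_le_cons_iff a).2 hB, by simp⟩
    · obtain ⟨B, hB, rfl⟩ := ih ((Multiset.le_cons_of_notMem ha).1 h)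
      exact ⟨B, hB.trans (Multiset.le_cons_self _ _), rfl⟩

/-- Over a finite group, `etaC` is attained: sequences of length at least `etaC G` do contain
short zero-sum subsequences. -/
theorem exists_short_zero_sum {G : Type*} [AddCommGroup G] [Finite G] {S : Multiset G}
    (hS : etaC G ≤ Multiset.card S) :
    ∃ S' ≤ S, S' ≠ 0 ∧ S'.sum = 0 ∧ Multiset.card S' ≤ AddMonoid.exponent G := by
  classical
  cases nonempty_fintype G
  have hexp : 0 < AddMonoid.exponent G :=
    Nat.pos_of_ne_zero AddMonoid.exponent_ne_zero_of_finite
  refine (Nat.sInf_mem (s := {t : ℕ | 0 < t ∧ ∀ S : Multiset G, t ≤ Multiset.card S →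
    ∃ S' ≤ S, S' ≠ 0 ∧ S'.sum = 0 ∧ Multiset.card S' ≤ AddMonoid.exponent G})
    ⟨Fintype.card G * AddMonoid.exponent G + 1, Nat.succ_pos _, fun T hT => ?_⟩).2 S hS
  obtain ⟨g, hg⟩ : ∃ g : G, AddMonoid.exponent G ≤ T.count g := by
    by_contra! hlt
    have hle := Finset.sum_le_sum fun g (_ : g ∈ (Finset.univ : Finset G)) => (hlt g).le
    rw [Multiset.sum_count_eq_card fun a _ => Finset.mem_univ a, Finset.sum_const,
      Finset.card_univ, smul_eq_mul] at hle
    omega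
  refine ⟨Multiset.replicate (AddMonoid.exponent G) g, Multiset.le_count_iff_replicate_le.1 hg,
    ?_, ?_, by simp⟩
  · rw [Ne, ← Multiset.card_eq_zero, Multiset.card_replicate]
    exact hexp.ne'
  · rw [Multiset.sum_replicate, AddMonoid.exponent_nsmul_eq_zero]

/-- The `p`-torsion of `C_{p^(a+1)}^r` is a homomorphic image of `C_p^r`. -/
theorem exists_hom_range_torsion (r p a : ℕ) (hp : 0 < p) :
    ∃ ι : (Fin r → ZMod p) →+ (Fin r → ZMod (p ^ (a + 1))),
      ∀ y, p • y = 0 → ∃ z, ι z = y := by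
  have : NeZero p := ⟨hp.ne'⟩
  let φ : ZMod p →+ ZMod (p ^ (a + 1)) := ZMod.lift p
    ⟨zmultiplesHom _ ((p ^ a : ℕ) : ZMod (p ^ (a + 1))), by
      rw [zmultiplesHom_apply, natCast_zsmul, nsmul_eq_mul, ← Nat.cast_mul,
        ZMod.natCast_eq_zero_iff, pow_succ']⟩
  have hφ (y : ZMod (p ^ (a + 1))) (hy : p • y = 0) : ∃ z, φ z = y := by
    rw [← ZMod.natCast_zmod_val y, nsmul_eq_mul, ← Nat.cast_mul, ZMod.natCast_eq_zero_iff] at hy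
    obtain ⟨k, hk⟩ := Nat.dvd_of_mul_dvd_mul_left hp ((pow_succ' p a).symm.dvd.trans hy)
    refine ⟨((k : ℤ) : ZMod p), ?_⟩
    rw [ZMod.lift_coe, zmultiplesHom_apply, natCast_zsmul, nsmul_eq_mul, ← Nat.cast_mul,
      mul_comm, ← hk, ZMod.natCast_zmod_val]
  refine ⟨φ.compLeft (Fin r), fun y hy => ?_⟩
  choose z hz using fun i => hφ (y i) (congrFun hy i)
  exact ⟨z, funext hz⟩

/-- Among `etaC (C_p^r)` elements of `C_{p^(a+1)}^r` killed by `p ^ (n + 1)` there are at most `p`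
whose sum is killed by `p ^ n`. -/
theorem exists_short_block {r p a n : ℕ} (hp : 0 < p) {T : Multiset (Fin r → ZMod (p ^ (a + 1)))}
    (hT : ∀ g ∈ T, p ^ (n + 1) • g = 0)
    (hcard : etaC (Fin r → ZMod p) ≤ Multiset.card T) :
    ∃ B ≤ T, B ≠ 0 ∧ Multiset.card B ≤ p ∧ p ^ n • B.sum = 0 := by
  have : NeZero p := ⟨hp.ne'⟩
  obtain ⟨ι, hι⟩ := exists_hom_range_torsion r p a hp
  have hlift (g : Fin r → ZMod (p ^ (a + 1))) : ∃ z, g ∈ T → ι z = p ^ n • g := by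
    by_cases hg : g ∈ T
    · obtain ⟨z, hz⟩ := hι (p ^ n • g) (by rw [smul_smul, ← pow_succ', hT g hg])
      exact ⟨z, fun _ => hz⟩
    · exact ⟨0, fun h => absurd h hg⟩
  choose f hf using hlift
  obtain ⟨W, hWT, hW0, hWsum, hWcard⟩ :=
    exists_short_zero_sum (S := T.map f) (by rwa [Multiset.card_map])
  obtain ⟨B, hBT, rfl⟩ := Multiset.exists_le_map_eq f hWT
  refine ⟨B, hBT, fun h => hW0 (by simp [h]), ?_, ?_⟩
  · rw [Multiset.card_map] at hWcard
    refine hWcard.trans (Nat.le_of_dvd hp (AddMonoid.exponent_dvd_of_forall_nsmul_eq_zero ?_))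
    intro z
    ext i
    simp
  · have hmap : B.map (ι ∘ f) = B.map fun g => p ^ n • g :=
      Multiset.map_congr rfl fun g hg => hf g (Multiset.mem_of_le hBT hg)
    have := congrArg ι hWsum
    rw [map_multiset_sum, Multiset.map_map, _root_.map_zero, hmap] at this
    rwa [Multiset.sum_map_nsmul, Multiset.map_id'] at this

/-- A sequence over the `p ^ n`-torsion of `C_{p^(a+1)}^r` without tiny zero-sum subsequence has
cross number at most `c (1 - p⁻ⁿ)`. -/
theorem crossNum_le_of_not_exists_isTinyZS {r p a : ℕ} (hp : p.Prime) {c : ℝ}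
    (hc : (etaC (Fin r → ZMod p) : ℝ) ≤ c * ((p : ℝ) - 1) + 1) (n : ℕ)
    (S : Multiset (Fin r → ZMod (p ^ (a + 1)))) (hS : ∀ g ∈ S, p ^ n • g = 0)
    (h : ¬ ∃ W ≤ S, IsTinyZS W) : crossNum S ≤ c * (1 - 1 / (p : ℝ) ^ n) := by
  classical
  have hp0 : (0 : ℝ) < p := by exact_mod_cast hp.pos
  induction n generalizing S with
  | zero =>
    obtain rfl : S = 0 := by
      refine Multiset.eq_zero_of_forall_notMem fun g hg => h ⟨{g}, by simpa using hg, ?_⟩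
      have hg0 : g = 0 := by simpa using hS g hg
      simp [IsTinyZS, crossNum, hg0]
    simp [crossNum]
  | succ n ih =>
    suffices H : ∀ (k : ℕ) (T U : Multiset (Fin r → ZMod (p ^ (a + 1)))), Multiset.card T = k →
        (∀ g ∈ T, addOrderOf g = p ^ (n + 1)) → (∀ g ∈ U, p ^ n • g = 0) →
        (¬ ∃ W ≤ T + U, IsTinyZS W) →
        crossNum (T + U) ≤ c * (1 - 1 / (p : ℝ) ^ (n + 1)) by
      have hsplit := Multiset.filter_add_not (fun g => ¬ p ^ n • g = 0) S
      rw [← hsplit] at h ⊢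
      refine H _ _ _ rfl (fun g hg => ?_) (fun g hg => ?_) h
      · rw [Multiset.mem_filter] at hg
        have := Fact.mk hp
        exact addOrderOf_eq_prime_pow hg.2 (hS g hg.1)
      · simpa using (Multiset.mem_filter.1 hg).2
    intro k
    induction k using Nat.strong_induction_on with
    | _ k ihk =>
    intro T U hk hT hU h
    have hcross (B : Multiset (Fin r → ZMod (p ^ (a + 1)))) (hB : B ≤ T) :
        crossNum B = Multiset.card B / (p : ℝ) ^ (n + 1) := by
      rw [crossNum, Multiset.map_congr rfl fun g hg => by
        rw [hT g (Multiset.mem_of_le hB hg)], Multiset.map_const', Multiset.sum_replicate]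
      simp [div_eq_mul_inv]
    rcases le_or_gt (etaC (Fin r → ZMod p)) (Multiset.card T) with hle | hlt
    · obtain ⟨B, hBT, hB0, hBcard, hBsum⟩ := exists_short_block hp.pos
        (fun g hg => by rw [← hT g hg, addOrderOf_nsmul_eq_zero]) hle
      obtain ⟨R, rfl⟩ := Multiset.le_iff_exists_add.1 hBT
      have hBle : crossNum B ≤ 1 / (addOrderOf B.sum : ℝ) := by
        have hdvd : addOrderOf B.sum ∣ p ^ n := addOrderOf_dvd_of_nsmul_eq_zero hBsum
        have hpos : 0 < addOrderOf B.sum := Nat.pos_of_dvd_of_pos hdvd (pow_pos hp.pos n)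
        have hord : (addOrderOf B.sum : ℝ) ≤ (p : ℝ) ^ n := by
          exact_mod_cast Nat.le_of_dvd (pow_pos hp.pos n) hdvd
        calc crossNum B = Multiset.card B / (p : ℝ) ^ (n + 1) := hcross B hBT
          _ ≤ p / (p : ℝ) ^ (n + 1) := by gcongr
          _ = 1 / (p : ℝ) ^ n := by field_simp; ring
          _ ≤ 1 / (addOrderOf B.sum : ℝ) :=
            one_div_le_one_div_of_le (by exact_mod_cast hpos) hord
      have hnot : ¬ ∃ W ≤ R + (B.sum ::ₘ U), IsTinyZS W := by
        rw [Multiset.add_cons]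
        exact not_exists_isTinyZS_cons_sum hB0 hBle (by rwa [← add_assoc])
      have hmain := ihk (Multiset.card R) (by
        have := Multiset.card_pos.2 hB0
        rw [Multiset.card_add] at hk
        omega) R (B.sum ::ₘ U) rfl (fun g hg => hT g (Multiset.mem_add.2 (Or.inr hg)))
        (by
          intro g hg
          rcases Multiset.mem_cons.1 hg with rfl | hg
          exacts [hBsum, hU g hg]) hnot
      rw [crossNum_add, crossNum_cons] at hmain
      rw [crossNum_add, crossNum_add]
      linarith
    · have hUle := ih U hU fun ⟨W, hW, hW'⟩ => h ⟨W, hW.trans (Multiset.le_add_left _ _), hW'⟩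
      have hTle : (Multiset.card T : ℝ) ≤ c * (p - 1) := by
        have : (Multiset.card T : ℝ) + 1 ≤ etaC (Fin r → ZMod p) := by exact_mod_cast hlt
        linarith
      rw [crossNum_add, hcross T le_rfl]
      calc _ ≤ c * (p - 1) / (p : ℝ) ^ (n + 1) + c * (1 - 1 / (p : ℝ) ^ n) := by gcongr
        _ = c * (1 - 1 / (p : ℝ) ^ (n + 1)) := by field_simp; ring

/-- If `η(C_m^r) ≤ c(m-1)+1` for all `m ≥ 1`, then for every prime `p` and every `α ≥ 1`,
`t(C_{p^α}^r) ≤ c(p^α - 1) + 1`. -/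
theorem stmt9 (r : ℕ) (hr : 0 < r) (c : ℝ) (hc0 : 0 < c)
    (hc : ∀ m : ℕ, 0 < m → (etaC (Fin r → ZMod m) : ℝ) ≤ c * ((m : ℝ) - 1) + 1)
    (p : ℕ) (hp : p.Prime) (α : ℕ) (hα : 0 < α) :
    (tC (Fin r → ZMod (p ^ α)) : ℝ) ≤ c * ((p : ℝ) ^ α - 1) + 1 := by
  obtain ⟨a, rfl⟩ : ∃ a, α = a + 1 := ⟨α - 1, by omega⟩
  have hp1 : (1 : ℝ) ≤ p := by exact_mod_cast hp.one_lt.le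
  have hpow : (0 : ℝ) < (p : ℝ) ^ (a + 1) := by positivity
  have hnonneg : 0 ≤ c * ((p : ℝ) ^ (a + 1) - 1) :=
    mul_nonneg hc0.le (sub_nonneg.2 (one_le_pow₀ hp1))
  have htC : tC (Fin r → ZMod (p ^ (a + 1))) ≤ ⌊c * ((p : ℝ) ^ (a + 1) - 1)⌋₊ + 1 := by
    refine Nat.sInf_le ⟨Nat.succ_pos _, fun S hS => ?_⟩
    by_contra hnot
    have hkill (g : Fin r → ZMod (p ^ (a + 1))) : p ^ (a + 1) • g = 0 := by
      ext i
      rw [Pi.smul_apply, nsmul_eq_mul, ZMod.natCast_self, zero_mul, Pi.zero_apply]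
    have hupper := crossNum_le_of_not_exists_isTinyZS hp (hc p hp.pos) (a + 1) S
      (fun g _ => hkill g) hnot
    have hlower : (Multiset.card S : ℝ) * (1 / (p : ℝ) ^ (a + 1)) ≤ crossNum S := by
      rw [← nsmul_eq_mul, crossNum, ← Multiset.card_map (fun g => 1 / (addOrderOf g : ℝ)) S]
      refine Multiset.card_nsmul_le_sum fun x hx => ?_
      obtain ⟨g, -, rfl⟩ := Multiset.mem_map.1 hx
      have hdvd := addOrderOf_dvd_of_nsmul_eq_zero (hkill g)
      have hpp := pow_pos hp.pos (a + 1)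
      exact one_div_le_one_div_of_le (by exact_mod_cast Nat.pos_of_dvd_of_pos hdvd hpp)
        (by exact_mod_cast Nat.le_of_dvd hpp hdvd)
    have hlt := Nat.lt_of_floor_lt (Nat.lt_of_succ_le hS)
    have hle : (Multiset.card S : ℝ) ≤ c * ((p : ℝ) ^ (a + 1) - 1) := by
      have := mul_le_mul_of_nonneg_right (hlower.trans hupper) hpow.le
      field_simp at this
      linarith
    linarith
  calc (tC (Fin r → ZMod (p ^ (a + 1))) : ℝ)
      ≤ (⌊c * ((p : ℝ) ^ (a + 1) - 1)⌋₊ : ℝ) + 1 := by exact_mod_cast htC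
    _ ≤ c * ((p : ℝ) ^ (a + 1) - 1) + 1 := by gcongr; exact Nat.floor_le hnonneg
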